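/- Simulations compose: if S and S' are sets of gizmos such that every gizmo in S' is simulated by S (equivalent, up to relabeling of locations, to the simulated gizmo of some simulation using only gizmos from S), and S' simulates a gizmo H, then S simulates H. -/

import Mathlib

/-- A traversal sequence on a location type `L`: a finite list of traversals `a → b`. -/
abbrev TravSeq (L : Type*) := List (L × L)

/-- A gizmo on `L`: a set of traversal sequences closed under inserting trivial
traversals and contracting consecutive composable traversals. -/
def IsGizmo {L : Type*} (G : Set (TravSeq L)) : Prop :=
  (∀ (X Y : TravSeq L) (a : L), X ++ Y ∈ G → X ++ [(a, a)] ++ Y ∈ G) ∧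
  (∀ (X Y : TravSeq L) (a b c : L), X ++ [(a, b), (b, c)] ++ Y ∈ G → X ++ [(a, c)] ++ Y ∈ G)

/-- A set of traversal sequences is prefix-closed if `X ++ Y ∈ G` implies `X ∈ G`. -/
def PrefixClosed {L : Type*} (G : Set (TravSeq L)) : Prop :=
  ∀ X Y : TravSeq L, X ++ Y ∈ G → X ∈ G

open scoped Classical in
/-- The subsequence of a traversal sequence on the disjoint union `Σ j, Loc j`
consisting of the traversals on the location set of the `i`-th gizmo,
viewed as a traversal sequence on `Loc i`. -/
noncomputable def projSeq {ι : Type*} {Loc : ι → Type*} (i : ι)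
    (Z : TravSeq (Σ j, Loc j)) : TravSeq (Loc i) :=
  Z.filterMap (fun p =>
    if h : p.1.1 = i ∧ p.2.1 = i then
      some (cast (congrArg Loc h.1) p.1.2, cast (congrArg Loc h.2) p.2.2)
    else none)

/-- `IsWalk s t Y` : the traversal sequence `Y` on the disjoint union of the constituent
location sets realizes the traversal `t` on the exposed locations: `Y` is nonempty, every
traversal of `Y` is a traversal on the location set of a single constituent gizmo, the
first entry starts in the class `t.1`, the last entry ends in the class `t.2`, and
consecutive entries are linked by the equivalence relation. -/
def IsWalk {ι : Type*} {Loc : ι → Type*} (s : Setoid (Σ j, Loc j))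
    {L : Set (Quotient s)} (t : ↥L × ↥L) (Y : TravSeq (Σ j, Loc j)) : Prop :=
  ∃ hY : Y ≠ [],
    (∀ p ∈ Y, p.1.1 = p.2.1) ∧
    Quotient.mk s (Y.head hY).1 = (t.1 : Quotient s) ∧
    Quotient.mk s (Y.getLast hY).2 = (t.2 : Quotient s) ∧
    List.Chain' (fun p q : (Σ j, Loc j) × (Σ j, Loc j) => s.r p.2 q.1) Y

/-- The simulated set of traversal sequences on the exposed classes `L`, for the
simulation given by the gizmos `G i`, the equivalence relation `s` on the disjoint union
of their location sets, and the subset `L` of equivalence classes: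
`X ∈ SimulatedGizmo G s L` iff there are walks `Y_j` through the network, one for each
traversal of `X`, such that for each `i` the concatenation (in order) of all the
traversals on the location set of `G i` lies in `G i`. -/
noncomputable def SimulatedGizmo {ι : Type*} {Loc : ι → Type*}
    (G : ∀ i, Set (TravSeq (Loc i))) (s : Setoid (Σ j, Loc j))
    (L : Set (Quotient s)) : Set (TravSeq ↥L) :=
  {X | ∃ Ys : List (TravSeq (Σ j, Loc j)),
        List.Forall₂ (IsWalk s) X Ys ∧
        ∀ i, projSeq i Ys.flatten ∈ G i}

/-- Two sets of traversal sequences are equivalent up to relabeling of locations if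
there is a bijection of location types carrying one to the other. -/
def GizmoEquiv {M : Type*} {N : Type*} (H : Set (TravSeq M)) (K : Set (TravSeq N)) : Prop :=
  ∃ e : M ≃ N, ∀ X : TravSeq M, X ∈ H ↔ X.map (fun p => (e p.1, e p.2)) ∈ K

/-- A set `S` of gizmos (presented as a family indexed by `σ`) simulates a gizmo `H`
if `H` is equivalent, up to relabeling of locations, to the simulated gizmo of some
simulation all of whose constituent gizmos are from `S`. -/
def Simulates {σ : Type u} {SLoc : σ → Type u} (S : ∀ j, Set (TravSeq (SLoc j)))
    {M : Type*} (H : Set (TravSeq M)) : Prop :=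
  ∃ (ι : Type u) (_ : Finite ι) (f : ι → σ)
    (s : Setoid (Σ i, SLoc (f i))) (L : Set (Quotient s)),
    GizmoEquiv H (SimulatedGizmo (fun i => S (f i)) s L)

/-- `IsPath φ q Y r`: the traversals of `Y`, read through the labelling `φ`, lead from `q` to `r`. -/
def IsPath {A Q : Type*} (φ : A → Q) : Q → TravSeq A → Q → Prop
  | q, [], r => q = r
  | q, p :: Y, r => φ p.1 = q ∧ IsPath φ (φ p.2) Y r

theorem IsPath.append {A Q : Type*} {φ : A → Q} {q r t : Q} {X Y : TravSeq A}
    (hX : IsPath φ q X r) (hY : IsPath φ r Y t) : IsPath φ q (X ++ Y) t := by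
  induction X generalizing q with
  | nil => cases hX; exact hY
  | cons p X ih => exact ⟨hX.1, ih hX.2⟩

theorem IsPath.map {A B Q R : Type*} {φ : A → Q} {χ : B → R} {f : A → B} {g : Q → R}
    (h : ∀ x, χ (f x) = g (φ x)) {q r : Q} {X : TravSeq A} (hX : IsPath φ q X r) :
    IsPath χ (g q) (X.map (Prod.map f f)) (g r) := by
  induction X generalizing q with
  | nil => exact congrArg g hX
  | cons p X ih =>
    refine ⟨by simp [h, hX.1], ?_⟩
    have := ih hX.2
    simpa [h] using this

theorem isPath_comp_iff {A Q R : Type*} {φ : A → Q} {g : Q → R} (hg : Function.Injective g)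
    {q r : Q} {X : TravSeq A} : IsPath (fun x => g (φ x)) (g q) X (g r) ↔ IsPath φ q X r := by
  induction X generalizing q with
  | nil => exact hg.eq_iff
  | cons p X ih => exact and_congr hg.eq_iff ih

theorem isPath_mk_iff {A : Type*} (s : Setoid A) {q r : Quotient s} {Y : TravSeq A}
    (hY : Y ≠ []) : IsPath (Quotient.mk s) q Y r ↔
      Quotient.mk s (Y.head hY).1 = q ∧ Quotient.mk s (Y.getLast hY).2 = r ∧
      List.IsChain (fun p p' : A × A => s.r p.2 p'.1) Y := by
  induction Y generalizing q with
  | nil => exact absurd rfl hY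
  | cons p Y ih =>
    cases Y with
    | nil => simp [IsPath]
    | cons p' Y =>
      have h := @ih (Quotient.mk s p.2) (by simp)
      have hr : Quotient.mk s p'.1 = Quotient.mk s p.2 ↔ s.r p.2 p'.1 :=
        eq_comm.trans Quotient.eq
      rw [IsPath, h]
      simp only [List.head_cons, List.isChain_cons_cons, hr,
        List.getLast_cons (List.cons_ne_nil p' Y)]
      tauto

theorem isWalk_iff {ι : Type*} {Loc : ι → Type*} (s : Setoid (Σ j, Loc j))
    {L : Set (Quotient s)} (t : ↥L × ↥L) (Y : TravSeq (Σ j, Loc j)) :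
    IsWalk s t Y ↔ Y ≠ [] ∧ (∀ p ∈ Y, p.1.1 = p.2.1) ∧
      IsPath (Quotient.mk s) t.1 Y (t.2 : Quotient s) := by
  constructor
  · rintro ⟨hY, h, h'⟩
    exact ⟨hY, h, (isPath_mk_iff s hY).2 h'⟩
  · rintro ⟨hY, h, h'⟩
    exact ⟨hY, h, (isPath_mk_iff s hY).1 h'⟩

section Projection

variable {ι : Type*} {Loc : ι → Type*}

theorem projSeq_append (i : ι) (X Y : TravSeq (Σ j, Loc j)) :
    projSeq i (X ++ Y) = projSeq i X ++ projSeq i Y :=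
  List.filterMap_append

theorem projSeq_cons_self (i : ι) (a b : Loc i) (Z : TravSeq (Σ j, Loc j)) :
    projSeq i ((⟨i, a⟩, ⟨i, b⟩) :: Z) = (a, b) :: projSeq i Z := by
  simp [projSeq]

theorem projSeq_cons_of_ne {i j : ι} (h : j ≠ i) (a : Loc j) (y : Σ j, Loc j)
    (Z : TravSeq (Σ j, Loc j)) :
    projSeq i ((⟨j, a⟩, y) :: Z) = projSeq i Z := by
  simp [projSeq, h]

theorem projSeq_cons_of_ne_right {i j : ι} (h : j ≠ i) (a : Loc j) (x : Σ j, Loc j)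
    (Z : TravSeq (Σ j, Loc j)) :
    projSeq i ((x, ⟨j, a⟩) :: Z) = projSeq i Z := by
  simp [projSeq, h]

end Projection

namespace SimulationComposition

variable {ι : Type*} {κ : ι → Type*} {Loc : ∀ i, κ i → Type*} {Loc' : ι → Type*}

/-- The inclusion of the locations of the `i`-th inner simulation into all inner locations. -/
def incl (i : ι) (x : Σ k, Loc i k) : Σ p : (Σ i, κ i), Loc p.1 p.2 :=
  ⟨⟨i, x.1⟩, x.2⟩

theorem projSeq_map_incl (i : ι) (k : κ i) (W : TravSeq (Σ k, Loc i k)) :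
    projSeq (Loc := fun p : (Σ i, κ i) => Loc p.1 p.2) ⟨i, k⟩
      (W.map (Prod.map (incl i) (incl i))) = projSeq k W := by
  induction W with
  | nil => rfl
  | cons p W ih =>
    obtain ⟨⟨k₁, x⟩, ⟨k₂, y⟩⟩ := p
    have hne : ∀ {k'}, k' ≠ k → (⟨i, k'⟩ : Σ i, κ i) ≠ ⟨i, k⟩ := by
      intro k' h h'
      cases h'
      exact h rfl
    by_cases h₁ : k₁ = k
    · by_cases h₂ : k₂ = k
      · subst h₁ h₂
        rw [projSeq_cons_self, ← ih]
        exact projSeq_cons_self (Loc := fun p : (Σ i, κ i) => Loc p.1 p.2) _ _ _ _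
      · rw [projSeq_cons_of_ne_right h₂, ← ih]
        exact projSeq_cons_of_ne_right (Loc := fun p : (Σ i, κ i) => Loc p.1 p.2) (hne h₂) _ _ _
    · rw [projSeq_cons_of_ne h₁, ← ih]
      exact projSeq_cons_of_ne (Loc := fun p : (Σ i, κ i) => Loc p.1 p.2) (hne h₁) _ _ _

theorem projSeq_map_incl_of_ne {i j : ι} (h : j ≠ i) (k : κ i) (W : TravSeq (Σ k, Loc j k)) :
    projSeq (Loc := fun p : (Σ i, κ i) => Loc p.1 p.2) ⟨i, k⟩
      (W.map (Prod.map (incl j) (incl j))) = [] := by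
  induction W with
  | nil => rfl
  | cons p W ih =>
    rw [← ih]
    refine projSeq_cons_of_ne (Loc := fun p : (Σ i, κ i) => Loc p.1 p.2) ?_ _ _ _
    intro h'
    exact h (congrArg Sigma.fst h')

variable (s : Setoid (Σ i, Loc' i)) (s' : ∀ i, Setoid (Σ k, Loc i k))
  {L' : ∀ i, Set (Quotient (s' i))} (e : ∀ i, Loc' i ≃ L' i)

open scoped Classical in
/-- The combined label of an inner class: an exposed class is labelled by the outer class of
the outer location it represents, and any other class by itself. -/
noncomputable def classLabel (i : ι) (c : Quotient (s' i)) :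
    Quotient s ⊕ (Σ i, Quotient (s' i)) :=
  if h : c ∈ L' i then .inl (Quotient.mk s ⟨i, (e i).symm ⟨c, h⟩⟩) else .inr ⟨i, c⟩

theorem classLabel_apply (i : ι) (a : Loc' i) :
    classLabel s s' e i (e i a) = .inl (Quotient.mk s ⟨i, a⟩) := by
  simp [classLabel]

/-- The combined label of an inner location. -/
noncomputable def label (x : Σ p : (Σ i, κ i), Loc p.1 p.2) :
    Quotient s ⊕ (Σ i, Quotient (s' i)) :=
  classLabel s s' e x.1.1 (Quotient.mk (s' x.1.1) ⟨x.1.2, x.2⟩)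

/-- `Realizes s' e t Y`: the inner traversals `Y` form a walk of a single inner simulation
realizing the outer traversal `t`. -/
def Realizes (t : (Σ i, Loc' i) × (Σ i, Loc' i))
    (Y : TravSeq (Σ p : (Σ i, κ i), Loc p.1 p.2)) : Prop :=
  ∃ (i : ι) (a b : Loc' i) (W : TravSeq (Σ k, Loc i k)),
    t = (⟨i, a⟩, ⟨i, b⟩) ∧ IsWalk (s' i) (e i a, e i b) W ∧
    Y = W.map (Prod.map (incl i) (incl i))

variable {s s' e}

theorem Realizes.isPath {t : (Σ i, Loc' i) × (Σ i, Loc' i)}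
    {Y : TravSeq (Σ p : (Σ i, κ i), Loc p.1 p.2)} (h : Realizes s' e t Y) :
    IsPath (label s s' e) (.inl (Quotient.mk s t.1)) Y (.inl (Quotient.mk s t.2)) := by
  obtain ⟨i, a, b, W, rfl, hW, rfl⟩ := h
  rw [isWalk_iff] at hW
  have := hW.2.2.map (χ := label s s' e) (f := incl i) (g := classLabel s s' e i)
    (fun _ => rfl)
  simpa only [classLabel_apply] using this

theorem Realizes.ne_nil {t : (Σ i, Loc' i) × (Σ i, Loc' i)}
    {Y : TravSeq (Σ p : (Σ i, κ i), Loc p.1 p.2)} (h : Realizes s' e t Y) : Y ≠ [] := by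
  obtain ⟨i, a, b, W, rfl, ⟨hW, -⟩, rfl⟩ := h
  simpa using hW

theorem Realizes.fst_eq {t : (Σ i, Loc' i) × (Σ i, Loc' i)}
    {Y : TravSeq (Σ p : (Σ i, κ i), Loc p.1 p.2)} (h : Realizes s' e t Y) :
    ∀ p ∈ Y, p.1.1 = p.2.1 := by
  obtain ⟨i, a, b, W, rfl, ⟨-, hW, -⟩, rfl⟩ := h
  intro p hp
  obtain ⟨w, hw, rfl⟩ := List.mem_map.1 hp
  exact congrArg (Sigma.mk i) (hW w hw)

theorem isPath_flatten {Z : TravSeq (Σ i, Loc' i)}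
    {Ws : List (TravSeq (Σ p : (Σ i, κ i), Loc p.1 p.2))}
    (h : List.Forall₂ (Realizes s' e) Z Ws) {q r : Quotient s}
    (hZ : IsPath (Quotient.mk s) q Z r) :
    IsPath (label s s' e) (.inl q) Ws.flatten (.inl r) := by
  induction h generalizing q with
  | nil => exact congrArg Sum.inl hZ
  | cons ht _ ih =>
    obtain ⟨rfl, hZ⟩ := hZ
    exact ht.isPath.append (ih hZ)

theorem forall_mem_flatten_fst_eq {Z : TravSeq (Σ i, Loc' i)}
    {Ws : List (TravSeq (Σ p : (Σ i, κ i), Loc p.1 p.2))}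
    (h : List.Forall₂ (Realizes s' e) Z Ws) : ∀ p ∈ Ws.flatten, p.1.1 = p.2.1 := by
  induction h with
  | nil => simp
  | cons ht _ ih =>
    intro p hp
    rw [List.flatten_cons, List.mem_append] at hp
    exact hp.elim (ht.fst_eq p) (ih p)

theorem forall_mem_fst_eq {Z : TravSeq (Σ i, Loc' i)}
    {Ws : List (TravSeq (Σ p : (Σ i, κ i), Loc p.1 p.2))}
    (h : List.Forall₂ (Realizes s' e) Z Ws) : ∀ p ∈ Z, p.1.1 = p.2.1 := by
  induction h with
  | nil => simp
  | cons ht _ ih =>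
    obtain ⟨i, a, b, W, rfl, -⟩ := ht
    exact List.forall_mem_cons.2 ⟨rfl, ih⟩

/-- A path in the combined labelling that ends at an outer class decomposes into walks of inner
simulations, after an initial inner segment if it starts at an inner class. -/
theorem exists_decomposition {r : Quotient s} (Y : TravSeq (Σ p : (Σ i, κ i), Loc p.1 p.2))
    (hY : ∀ p ∈ Y, p.1.1 = p.2.1) :
    (∀ q, IsPath (label s s' e) (.inl q) Y (.inl r) →
      ∃ Z Ws, IsPath (Quotient.mk s) q Z r ∧ List.Forall₂ (Realizes s' e) Z Ws ∧
        Y = Ws.flatten) ∧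
    (∀ i c, IsPath (label s s' e) (classLabel s s' e i c) Y (.inl r) →
      ∃ (b : Loc' i) (W : TravSeq (Σ k, Loc i k)) (Z : TravSeq (Σ i, Loc' i))
        (Ws : List (TravSeq (Σ p : (Σ i, κ i), Loc p.1 p.2))),
        IsPath (Quotient.mk (s' i)) c W (e i b) ∧ (∀ p ∈ W, p.1.1 = p.2.1) ∧
        IsPath (Quotient.mk s) (Quotient.mk s ⟨i, b⟩) Z r ∧
        List.Forall₂ (Realizes s' e) Z Ws ∧
        Y = W.map (Prod.map (incl i) (incl i)) ++ Ws.flatten) := by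
  have of_exposed : ∀ Y : TravSeq (Σ p : (Σ i, κ i), Loc p.1 p.2),
      (∀ q, IsPath (label s s' e) (.inl q) Y (.inl r) →
        ∃ Z Ws, IsPath (Quotient.mk s) q Z r ∧ List.Forall₂ (Realizes s' e) Z Ws ∧
          Y = Ws.flatten) →
      ∀ i (a : Loc' i), IsPath (label s s' e) (classLabel s s' e i (e i a)) Y (.inl r) →
      ∃ (b : Loc' i) (W : TravSeq (Σ k, Loc i k)) (Z : TravSeq (Σ i, Loc' i))
        (Ws : List (TravSeq (Σ p : (Σ i, κ i), Loc p.1 p.2))),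
        IsPath (Quotient.mk (s' i)) (e i a) W (e i b) ∧ (∀ p ∈ W, p.1.1 = p.2.1) ∧
        IsPath (Quotient.mk s) (Quotient.mk s ⟨i, b⟩) Z r ∧
        List.Forall₂ (Realizes s' e) Z Ws ∧
        Y = W.map (Prod.map (incl i) (incl i)) ++ Ws.flatten := by
    intro Y h i a hp
    rw [classLabel_apply] at hp
    obtain ⟨Z, Ws, hZ, hR, rfl⟩ := h _ hp
    exact ⟨a, [], Z, Ws, rfl, by simp, hZ, hR, rfl⟩
  induction Y with
  | nil =>
    have h : ∀ q, IsPath (label s s' e) (.inl q) [] (.inl r) →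
        ∃ Z Ws, IsPath (Quotient.mk s) q Z r ∧ List.Forall₂ (Realizes s' e) Z Ws ∧
          ([] : TravSeq (Σ p : (Σ i, κ i), Loc p.1 p.2)) = Ws.flatten :=
      fun q hq => ⟨[], [], Sum.inl_injective hq, .nil, rfl⟩
    refine ⟨h, fun i c hc => ?_⟩
    by_cases hL : c ∈ L' i
    · obtain ⟨a, ha⟩ := (e i).surjective ⟨c, hL⟩
      obtain rfl : (e i a : Quotient (s' i)) = c := by rw [ha]
      exact of_exposed _ h i a hc
    · simp [IsPath, classLabel, hL] at hc
  | cons p Y ih =>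
    obtain ⟨hp, hY⟩ := List.forall_mem_cons.1 hY
    obtain ⟨-, ih⟩ := ih hY
    obtain ⟨⟨⟨j, k⟩, x⟩, ⟨jk, y⟩⟩ := p
    obtain rfl : (⟨j, k⟩ : Σ i, κ i) = jk := hp
    have h : ∀ q, IsPath (label s s' e) (.inl q) ((⟨⟨j, k⟩, x⟩, ⟨⟨j, k⟩, y⟩) :: Y) (.inl r) →
        ∃ Z Ws, IsPath (Quotient.mk s) q Z r ∧ List.Forall₂ (Realizes s' e) Z Ws ∧
          (⟨⟨j, k⟩, x⟩, ⟨⟨j, k⟩, y⟩) :: Y = Ws.flatten := by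
      rintro q ⟨hq, hpath⟩
      obtain ⟨b, W, Z, Ws, hW, hW', hZ, hR, rfl⟩ := ih j _ hpath
      change classLabel s s' e j (Quotient.mk (s' j) ⟨k, x⟩) = _ at hq
      by_cases hL : Quotient.mk (s' j) ⟨k, x⟩ ∈ L' j
      · obtain ⟨a, ha⟩ := (e j).surjective ⟨_, hL⟩
        have ha' : (e j a : Quotient (s' j)) = Quotient.mk (s' j) ⟨k, x⟩ := by rw [ha]
        rw [← ha', classLabel_apply] at hq
        refine ⟨(⟨j, a⟩, ⟨j, b⟩) :: Z,
          (((⟨k, x⟩, ⟨k, y⟩) :: W).map (Prod.map (incl j) (incl j))) :: Ws,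
          ⟨Sum.inl_injective hq, hZ⟩, .cons ⟨j, a, b, _, rfl, ?_, rfl⟩ hR, rfl⟩
        rw [isWalk_iff]
        exact ⟨by simp, List.forall_mem_cons.2 ⟨rfl, hW'⟩, ha'.symm, hW⟩
      · simp [classLabel, hL] at hq
    refine ⟨h, fun i c hc => ?_⟩
    by_cases hL : c ∈ L' i
    · obtain ⟨a, ha⟩ := (e i).surjective ⟨c, hL⟩
      obtain rfl : (e i a : Quotient (s' i)) = c := by rw [ha]
      exact of_exposed _ h i a hc
    · obtain ⟨hq, hpath⟩ := hc
      obtain ⟨b, W, Z, Ws, hW, hW', hZ, hR, rfl⟩ := ih j _ hpath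
      change classLabel s s' e j (Quotient.mk (s' j) ⟨k, x⟩) = _ at hq
      by_cases hL' : Quotient.mk (s' j) ⟨k, x⟩ ∈ L' j
      · simp [classLabel, hL, hL'] at hq
      · simp only [classLabel, hL, hL', dite_false] at hq
        have hq := Sum.inr_injective hq
        cases hq
        exact ⟨b, (⟨k, x⟩, ⟨k, y⟩) :: W, Z, Ws, ⟨rfl, hW⟩, List.forall_mem_cons.2 ⟨rfl, hW'⟩,
          hZ, hR, rfl⟩

theorem exists_inner_walks {Z : TravSeq (Σ i, Loc' i)}
    {Ws : List (TravSeq (Σ p : (Σ i, κ i), Loc p.1 p.2))}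
    (h : List.Forall₂ (Realizes s' e) Z Ws) (i : ι) :
    ∃ Vs, List.Forall₂ (IsWalk (s' i)) ((projSeq i Z).map (fun p => (e i p.1, e i p.2))) Vs ∧
      ∀ k, projSeq k Vs.flatten =
        projSeq (Loc := fun p : (Σ i, κ i) => Loc p.1 p.2) ⟨i, k⟩ Ws.flatten := by
  induction h with
  | nil => exact ⟨[], .nil, fun _ => rfl⟩
  | cons ht _ ih =>
    obtain ⟨Vs, hVs, hproj⟩ := ih
    obtain ⟨j, a, b, W, rfl, hW, rfl⟩ := ht
    by_cases hj : j = i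
    · subst hj
      refine ⟨W :: Vs, ?_, fun k => ?_⟩
      · rw [projSeq_cons_self]
        exact .cons hW hVs
      · rw [List.flatten_cons, List.flatten_cons, projSeq_append, projSeq_append, hproj,
          projSeq_map_incl]
    · refine ⟨Vs, ?_, fun k => ?_⟩
      · rwa [projSeq_cons_of_ne hj]
      · rw [List.flatten_cons, projSeq_append, hproj, projSeq_map_incl_of_ne hj, List.nil_append]

open scoped Classical in
theorem exists_realization (Z : TravSeq (Σ i, Loc' i)) (hZ : ∀ p ∈ Z, p.1.1 = p.2.1)
    (Vs : ∀ i, List (TravSeq (Σ k, Loc i k)))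
    (hVs : ∀ i, List.Forall₂ (IsWalk (s' i))
      ((projSeq i Z).map (fun p => (e i p.1, e i p.2))) (Vs i)) :
    ∃ Ws, List.Forall₂ (Realizes s' e) Z Ws ∧
      ∀ i k, projSeq (Loc := fun p : (Σ i, κ i) => Loc p.1 p.2) ⟨i, k⟩ Ws.flatten =
        projSeq k (Vs i).flatten := by
  induction Z generalizing Vs with
  | nil =>
    refine ⟨[], .nil, fun i k => ?_⟩
    have h := hVs i
    change List.Forall₂ _ [] _ at h
    rw [List.forall₂_nil_left_iff.1 h]
    rfl
  | cons p Z ih =>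
    obtain ⟨hp, hZ'⟩ := List.forall_mem_cons.1 hZ
    obtain ⟨⟨j, a⟩, ⟨j', b⟩⟩ := p
    obtain rfl : j = j' := hp
    have hj := hVs j
    rw [projSeq_cons_self, List.map_cons, List.forall₂_cons_left_iff] at hj
    obtain ⟨W, Vj, hW, hVj, hV⟩ := hj
    obtain ⟨Ws, hR, hproj⟩ := ih hZ' (Function.update Vs j Vj) (by
      intro i
      by_cases hij : j = i
      · subst hij
        simpa using hVj
      · have := hVs i
        rw [projSeq_cons_of_ne hij] at this
        rwa [Function.update_of_ne (Ne.symm hij)])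
    refine ⟨W.map (Prod.map (incl j) (incl j)) :: Ws, .cons ⟨j, a, b, W, rfl, hW, rfl⟩ hR,
      fun i k => ?_⟩
    rw [List.flatten_cons, projSeq_append, hproj]
    by_cases hij : j = i
    · subst hij
      rw [Function.update_self, projSeq_map_incl, hV, List.flatten_cons, projSeq_append]
    · rw [Function.update_of_ne (Ne.symm hij), projSeq_map_incl_of_ne hij, List.nil_append]

theorem exists_forall₂_of_flatten {A B : Type*} {R : A → B → Prop} {Zs : List (List A)}
    {Ws : List B} (h : List.Forall₂ R Zs.flatten Ws) :
    ∃ Wss, List.Forall₂ (List.Forall₂ R) Zs Wss ∧ Ws = Wss.flatten := by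
  induction Zs generalizing Ws with
  | nil => exact ⟨[], .nil, List.forall₂_nil_left_iff.1 h⟩
  | cons Z Zs ih =>
    rw [List.flatten_cons] at h
    obtain ⟨Wss, hR, hW⟩ := ih (List.forall₂_drop_append _ _ _ h.flip).flip
    refine ⟨Ws.take Z.length :: Wss, .cons (List.forall₂_take_append _ _ _ h.flip).flip hR, ?_⟩
    rw [List.flatten_cons, ← hW, List.take_append_drop]

theorem forall₂_flatten {A B : Type*} {R : A → B → Prop} {Zs : List (List A)}
    {Wss : List (List B)} (h : List.Forall₂ (List.Forall₂ R) Zs Wss) :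
    List.Forall₂ R Zs.flatten Wss.flatten := by
  induction h with
  | nil => exact .nil
  | cons h _ ih => exact List.rel_append h ih

variable (s s' e) in
/-- The equivalence relation of the combined simulation: equality of labels. -/
noncomputable def combined : Setoid (Σ p : (Σ i, κ i), Loc p.1 p.2) :=
  Setoid.ker (label s s' e)

variable (s s' e) in
/-- The label of a class of the combined simulation. -/
noncomputable def combinedLabel : Quotient (combined s s' e) →
    Quotient s ⊕ (Σ i, Quotient (s' i)) :=
  Quotient.lift (label s s' e) (fun _ _ h => h)

theorem combinedLabel_injective : Function.Injective (combinedLabel s s' e) := by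
  rintro ⟨x⟩ ⟨y⟩ h
  exact Quotient.sound h

theorem exists_combinedLabel_eq (q : Quotient s) :
    ∃ x, combinedLabel s s' e x = .inl q := by
  obtain ⟨⟨i, a⟩⟩ := q
  obtain ⟨⟨k, x⟩, hx⟩ := Quotient.exists_rep (e i a : Quotient (s' i))
  refine ⟨Quotient.mk _ ⟨⟨i, k⟩, x⟩, ?_⟩
  have := classLabel_apply s s' e i a
  rw [← hx] at this
  exact this

theorem isWalk_combined_iff {L : Set (Quotient s)} {L₀ : Set (Quotient (combined s s' e))}
    {t : L × L} {t₀ : L₀ × L₀} (h₁ : combinedLabel s s' e t₀.1 = .inl t.1)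
    (h₂ : combinedLabel s s' e t₀.2 = .inl t.2)
    (Y : TravSeq (Σ p : (Σ i, κ i), Loc p.1 p.2)) :
    IsWalk (combined s s' e) t₀ Y ↔
      ∃ Z, IsWalk s t Z ∧ ∃ Ws, List.Forall₂ (Realizes s' e) Z Ws ∧ Y = Ws.flatten := by
  rw [isWalk_iff, ← isPath_comp_iff (combinedLabel_injective (s := s) (s' := s') (e := e)),
    h₁, h₂]
  constructor
  · rintro ⟨hne, hY, hpath⟩
    obtain ⟨Z, Ws, hZ, hR, rfl⟩ := (exists_decomposition Y hY).1 _ hpath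
    refine ⟨Z, (isWalk_iff _ _ _).2 ⟨?_, forall_mem_fst_eq hR, hZ⟩, Ws, hR, rfl⟩
    rintro rfl
    rw [List.forall₂_nil_left_iff.1 hR] at hne
    exact hne rfl
  · rintro ⟨Z, hZ, Ws, hR, rfl⟩
    obtain ⟨hne, -, hZ⟩ := (isWalk_iff _ _ _).1 hZ
    refine ⟨?_, forall_mem_flatten_fst_eq hR, isPath_flatten hR hZ⟩
    cases hR with
    | nil => exact absurd rfl hne
    | cons ht _ => simp [ht.ne_nil]

theorem forall₂_isWalk_combined_iff {L : Set (Quotient s)}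
    {L₀ : Set (Quotient (combined s s' e))} {θ : L → L₀}
    (hθ : ∀ q, combinedLabel s s' e (θ q) = .inl (q : Quotient s)) (X : TravSeq L)
    (Ys : List (TravSeq (Σ p : (Σ i, κ i), Loc p.1 p.2))) :
    List.Forall₂ (IsWalk (combined s s' e)) (X.map (fun p => (θ p.1, θ p.2))) Ys ↔
      ∃ Zs, List.Forall₂ (IsWalk s) X Zs ∧
        ∃ Wss, List.Forall₂ (List.Forall₂ (Realizes s' e)) Zs Wss ∧
          Ys = Wss.map List.flatten := by
  induction X generalizing Ys with
  | nil => simp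
  | cons t X ih =>
    rw [List.map_cons, List.forall₂_cons_left_iff]
    constructor
    · rintro ⟨Y, Ys, hY, hYs, rfl⟩
      obtain ⟨Z, hZ, Ws, hR, rfl⟩ := (isWalk_combined_iff (t := t) (hθ _) (hθ _) Y).1 hY
      obtain ⟨Zs, hZs, Wss, hRs, rfl⟩ := (ih Ys).1 hYs
      exact ⟨Z :: Zs, .cons hZ hZs, Ws :: Wss, .cons hR hRs, rfl⟩
    · rintro ⟨_, hZs, Wss, hRs, rfl⟩
      cases hZs with
      | cons hZ hZs =>
        cases hRs with
        | cons hR hRs =>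
          exact ⟨_, _, (isWalk_combined_iff (t := t) (hθ _) (hθ _) _).2 ⟨_, hZ, _, hR, rfl⟩,
            (ih _).2 ⟨_, hZs, _, hRs, rfl⟩, rfl⟩

/-- Substituting a simulation for every gizmo of a simulation does not change the simulated
gizmo. -/
theorem map_mem_simulatedGizmo_combined_iff {G : ∀ i k, Set (TravSeq (Loc i k))}
    {G' : ∀ i, Set (TravSeq (Loc' i))}
    (hG : ∀ i (X : TravSeq (Loc' i)), X ∈ G' i ↔
      X.map (fun p => (e i p.1, e i p.2)) ∈ SimulatedGizmo (G i) (s' i) (L' i))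
    {L : Set (Quotient s)} {L₀ : Set (Quotient (combined s s' e))} {θ : L → L₀}
    (hθ : ∀ q, combinedLabel s s' e (θ q) = .inl (q : Quotient s)) (X : TravSeq L) :
    X.map (fun p => (θ p.1, θ p.2)) ∈
      SimulatedGizmo (fun p : (Σ i, κ i) => G p.1 p.2) (combined s s' e) L₀ ↔
      X ∈ SimulatedGizmo G' s L := by
  constructor
  · rintro ⟨Ys, hYs, hproj⟩
    obtain ⟨Zs, hZs, Wss, hR, rfl⟩ := (forall₂_isWalk_combined_iff hθ X Ys).1 hYs
    refine ⟨Zs, hZs, fun i => (hG i _).2 ?_⟩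
    obtain ⟨Vs, hVs, hk⟩ := exists_inner_walks (forall₂_flatten hR) i
    refine ⟨Vs, hVs, fun k => ?_⟩
    rw [hk, List.flatten_flatten]
    exact hproj ⟨i, k⟩
  · rintro ⟨Zs, hZs, hproj⟩
    choose Vs hVs hk using fun i => (hG i _).1 (hproj i)
    have hblock : ∀ p ∈ Zs.flatten, p.1.1 = p.2.1 := by
      intro p hp
      obtain ⟨Z, hZ, hpZ⟩ := List.mem_flatten.1 hp
      obtain ⟨n, hn, rfl⟩ := List.getElem_of_mem hZ
      exact (List.Forall₂.get hZs (hZs.length_eq ▸ hn) hn).2.1 p hpZ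
    obtain ⟨Ws, hR, hW⟩ := exists_realization _ hblock Vs hVs
    obtain ⟨Wss, hRs, rfl⟩ := exists_forall₂_of_flatten hR
    refine ⟨_, (forall₂_isWalk_combined_iff hθ X _).2 ⟨Zs, hZs, Wss, hRs, rfl⟩, ?_⟩
    rintro ⟨i, k⟩
    rw [← List.flatten_flatten, hW]
    exact hk i k

end SimulationComposition

/-- Simulations compose: if `S` and `S'` are sets of gizmos such that
every gizmo in `S'` is simulated by `S`, and `S'` simulates a gizmo `H`, then `S`
simulates `H`. -/
theorem simulates_trans {σ : Type u} {σ' : Type u} {SLoc : σ → Type u}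
    {S'Loc : σ' → Type u}
    (S : ∀ j, Set (TravSeq (SLoc j))) (hS : ∀ j, IsGizmo (S j))
    (S' : ∀ j, Set (TravSeq (S'Loc j))) (hS' : ∀ j, IsGizmo (S' j))
    {M : Type*} (H : Set (TravSeq M)) (hH : IsGizmo H)
    (h1 : ∀ j', Simulates S (S' j'))
    (h2 : Simulates S' H) :
    Simulates S H := by
  obtain ⟨ι, _, f, s, L, e₀, he₀⟩ := h2
  choose κ hκ g s' L' e he using fun i => h1 (f i)
  choose ρ hρ using SimulationComposition.exists_combinedLabel_eq (s := s) (s' := s') (e := e)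
  let L₀ : Set (Quotient (SimulationComposition.combined s s' e)) :=
    {x | ∃ q ∈ L, SimulationComposition.combinedLabel s s' e x = .inl q}
  let θ : L → L₀ := fun q => ⟨ρ q, q, q.2, hρ q⟩
  have hθ : Function.Bijective θ := by
    constructor
    · intro q r h
      have h : ρ q = ρ r := congrArg Subtype.val h
      have h' := hρ q
      rw [h, hρ r] at h'
      exact Subtype.ext (Sum.inl_injective h'.symm)
    · rintro ⟨x, q, hq, hx⟩
      exact ⟨⟨q, hq⟩, Subtype.ext
        (SimulationComposition.combinedLabel_injective ((hρ q).trans hx.symm))⟩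
  refine ⟨Σ i, κ i, inferInstance, fun p => g p.1 p.2,
    SimulationComposition.combined s s' e, L₀, e₀.trans (Equiv.ofBijective θ hθ), fun X => ?_⟩
  rw [he₀, ← SimulationComposition.map_mem_simulatedGizmo_combined_iff he
    (θ := θ) (fun q => hρ q), List.map_map]
  rfl
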